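/- Let (a_g)_{g≥1} and (d_g)_{g≥1} be sequences of positive real numbers such that (a_g) satisfies the volume recursion and (d_g) satisfies the Siegel–Veech recursion relative to (a_g), and for g ≥ 1 set c_g = d_g/(4π²·a_g). Then c_g = 1/2 − 1/(4g) + O(1/g²) as g → ∞; that is, there exist C > 0 and g_0 such that for all g ≥ g_0, |c_g − 1/2 + 1/(4g)| ≤ C/g². -/

import Mathlib

open Finset Real

noncomputable section

/-- `b_g = ((2^(2g-1) - 1)/2^(2g-1)) · |B_{2g}|/(2g)!` for `g ≥ 1`, and `b_0 = 1`. -/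
def bSeq (g : ℕ) : ℚ :=
  if g = 0 then 1
  else ((2 ^ (2 * g - 1) - 1) / 2 ^ (2 * g - 1)) * |bernoulli (2 * g)| /
    (Nat.factorial (2 * g) : ℚ)

/-- The sequence `b_g` viewed as real numbers. -/
def bR (g : ℕ) : ℝ := (bSeq g : ℝ)

/-- The sum over ordered `k`-tuples of positive integers with sum `g` of
`∏_j (2 d_j - 1) a_{d_j}`. -/
def tupleSum (a : ℕ → ℝ) (k g : ℕ) : ℝ :=
  ∑ d ∈ (Finset.Nat.antidiagonalTuple k g).filter (fun d => ∀ j, 0 < d j),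
    ∏ j, ((2 * (d j : ℝ) - 1) * a (d j))

/-- The volume recursion for a sequence `(a_g)_{g ≥ 1}`:
`b_g = Σ_{k=1}^{g} (1/(k!·(2g−k)!)) · Σ_{d_1+⋯+d_k=g} ∏ (2d_j−1)·a_{d_j}`. -/
def VolumeRecursion (a : ℕ → ℝ) : Prop :=
  ∀ g : ℕ, 1 ≤ g →
    bR g = ∑ k ∈ Finset.Icc 1 g,
      (1 / ((Nat.factorial k * Nat.factorial (2 * g - k) : ℕ) : ℝ)) * tupleSum a k g

/-- The Siegel–Veech recursion for `(d_g)_{g ≥ 1}` relative to `(a_g)_{g ≥ 1}`: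
`b_{g−1}/2 = Σ_{g'=1}^{g} Σ_{k=0}^{g−g'} ((2g'−1)·d_{g'}/(k!·(2g−1−k)!)) ·
Σ_{g_1+⋯+g_k=g−g'} ∏ (2g_i−1)·a_{g_i}`. -/
def SVRecursion (a d : ℕ → ℝ) : Prop :=
  ∀ g : ℕ, 1 ≤ g →
    bR (g - 1) / 2 =
      ∑ g' ∈ Finset.Icc 1 g, ∑ k ∈ Finset.range (g - g' + 1),
        ((2 * (g' : ℝ) - 1) * d g' /
          ((Nat.factorial k * Nat.factorial (2 * g - 1 - k) : ℕ) : ℝ)) *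
          tupleSum a k (g - g')

/-- The generating series with constant term `c` and coefficients `(2 g - 1) a_g` for `g ≥ 1`. -/
def weightSeries (c : ℝ) (a : ℕ → ℝ) : PowerSeries ℝ :=
  PowerSeries.mk fun g => if g = 0 then c else (2 * (g : ℝ) - 1) * a g

lemma coeff_weightSeries_of_pos (c : ℝ) (a : ℕ → ℝ) {g : ℕ} (hg : 1 ≤ g) :
    PowerSeries.coeff g (weightSeries c a) = (2 * (g : ℝ) - 1) * a g := by
  simp [weightSeries, Nat.ne_of_gt hg]

lemma weightSeries_one_eq (a : ℕ → ℝ) : weightSeries 1 a = weightSeries 0 a + 1 := by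
  ext n
  by_cases hn : n = 0 <;> simp [weightSeries, PowerSeries.coeff_one, hn]

lemma tupleSum_eq_coeff (a : ℕ → ℝ) (k g : ℕ) :
    tupleSum a k g = PowerSeries.coeff g (weightSeries 0 a ^ k) := by
  have h := PowerSeries.coeff_prod (fun _ : Fin k => weightSeries 0 a) g Finset.univ
  rw [Finset.prod_const, Finset.card_univ, Fintype.card_fin] at h
  rw [h, tupleSum, Finset.sum_filter]
  symm
  refine Finset.sum_equiv Finsupp.equivFunOnFinite ?_ ?_
  · intro l
    simp [Finset.mem_finsuppAntidiag, Finset.Nat.mem_antidiagonalTuple]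
  · intro l _
    simp only [weightSeries, PowerSeries.coeff_mk, Finsupp.equivFunOnFinite_apply]
    split_ifs with hl
    · exact Finset.prod_congr rfl fun j _ => if_neg (hl j).ne'
    · push Not at hl
      obtain ⟨j, hj⟩ := hl
      exact Finset.prod_eq_zero (Finset.mem_univ j) (if_pos (by omega))

lemma tupleSum_nonneg {a : ℕ → ℝ} (hapos : ∀ g : ℕ, 1 ≤ g → 0 < a g) (k g : ℕ) :
    0 ≤ tupleSum a k g := by
  refine Finset.sum_nonneg fun d hd => Finset.prod_nonneg fun j _ => ?_
  have hj : 1 ≤ d j := (Finset.mem_filter.1 hd).2 j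
  have : (1 : ℝ) ≤ d j := by exact_mod_cast hj
  exact mul_nonneg (by linarith) (hapos _ hj).le

lemma tupleSum_eq_zero (a : ℕ → ℝ) {k g : ℕ} (h : g < k) : tupleSum a k g = 0 := by
  refine Finset.sum_eq_zero fun d hd => ?_
  obtain ⟨hd, hpos⟩ := Finset.mem_filter.1 hd
  rw [Finset.Nat.mem_antidiagonalTuple] at hd
  have : ∑ _j : Fin k, 1 ≤ ∑ j, d j := Finset.sum_le_sum fun j _ => hpos j
  simp at this
  omega

/-- The coefficient of degree `i` in the `p`-th power of `1 + Σ (2 g - 1) a_g t^g`. -/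
def powCoeff (a : ℕ → ℝ) (p i : ℕ) : ℝ := PowerSeries.coeff i (weightSeries 1 a ^ p)

lemma powCoeff_eq_sum (a : ℕ → ℝ) (p i : ℕ) :
    powCoeff a p i = ∑ k ∈ Finset.range (i + 1), (p.choose k : ℝ) * tupleSum a k i := by
  have h1 : powCoeff a p i = ∑ k ∈ Finset.range (p + 1), (p.choose k : ℝ) * tupleSum a k i := by
    rw [powCoeff, weightSeries_one_eq, add_pow, map_sum]
    refine Finset.sum_congr rfl fun k _ => ?_
    rw [one_pow, mul_one, tupleSum_eq_coeff, mul_comm, ← map_natCast (PowerSeries.C (R := ℝ)),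
      PowerSeries.coeff_C_mul]
  have h2 : ∀ q, p ≤ q → i ≤ q →
      ∑ k ∈ Finset.range (p + 1), (p.choose k : ℝ) * tupleSum a k i =
        ∑ k ∈ Finset.range (i + 1), (p.choose k : ℝ) * tupleSum a k i := by
    intro q hp hi
    rw [Finset.sum_subset (Finset.range_mono (show p + 1 ≤ q + 1 by omega)),
      ← Finset.sum_subset (Finset.range_mono (show i + 1 ≤ q + 1 by omega))]
    · intro k _ hk
      rw [tupleSum_eq_zero a (by simpa using hk), mul_zero]
    · intro k _ hk
      rw [Nat.choose_eq_zero_of_lt (by simpa using hk), Nat.cast_zero, zero_mul]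
  rw [h1, h2 (max p i) (le_max_left _ _) (le_max_right _ _)]

lemma powCoeff_nonneg {a : ℕ → ℝ} (hapos : ∀ g : ℕ, 1 ≤ g → 0 < a g) (p i : ℕ) :
    0 ≤ powCoeff a p i := by
  rw [powCoeff_eq_sum]
  exact Finset.sum_nonneg fun k _ => mul_nonneg (Nat.cast_nonneg _) (tupleSum_nonneg hapos _ _)

lemma powCoeff_zero (a : ℕ → ℝ) (p : ℕ) : powCoeff a p 0 = 1 := by
  simp [powCoeff_eq_sum, tupleSum]

lemma tupleSum_zero_of_pos (a : ℕ → ℝ) {i : ℕ} (hi : 1 ≤ i) : tupleSum a 0 i = 0 := by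
  rw [tupleSum_eq_coeff, pow_zero, PowerSeries.coeff_one, if_neg (by omega)]

lemma bR_eq_sum_range {a : ℕ → ℝ} (ha : VolumeRecursion a) {i : ℕ} (hi : 1 ≤ i) :
    bR i = ∑ k ∈ Finset.range (i + 1),
      (1 / ((k.factorial * (2 * i - k).factorial : ℕ) : ℝ)) * tupleSum a k i := by
  rw [ha i hi]
  refine Finset.sum_subset (fun k hk => ?_) fun k hk hk' => ?_
  · simp at hk ⊢; omega
  · have : k = 0 := by simp at hk hk'; omega
    rw [this, tupleSum_zero_of_pos a hi, mul_zero]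

lemma powCoeff_one (a : ℕ → ℝ) (p : ℕ) : powCoeff a p 1 = p * a 1 := by
  have h : tupleSum a 1 1 = a 1 := by
    rw [tupleSum_eq_coeff, pow_one, coeff_weightSeries_of_pos _ _ le_rfl]; norm_num
  rw [powCoeff_eq_sum, Finset.sum_range_succ, Finset.sum_range_one,
    tupleSum_zero_of_pos a le_rfl, h]
  simp

lemma factorial_mul_factorial_le {k i p : ℕ} (hk : k ≤ i) (hp : 2 * i ≤ p) :
    (2 * i - k).factorial * (p - i).factorial ≤ (p - k).factorial * i.factorial := by
  obtain ⟨s, rfl⟩ := Nat.exists_eq_add_of_le hk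
  obtain ⟨t, rfl⟩ := Nat.exists_eq_add_of_le hp
  have h1 : 2 * (k + s) - k = (k + s) + s := by omega
  have h2 : 2 * (k + s) + t - (k + s) = k + s + t := by omega
  have h3 : 2 * (k + s) + t - k = (k + s + t) + s := by omega
  rw [h1, h2, h3, ← Nat.factorial_mul_ascFactorial (k + s) s,
    ← Nat.factorial_mul_ascFactorial (k + s + t) s]
  have : (k + s + 1).ascFactorial s ≤ (k + s + t + 1).ascFactorial s := by
    simp only [Nat.ascFactorial_eq_prod_range]
    exact Finset.prod_le_prod' fun i _ => by omega
  calc _ = (k + s).factorial * (k + s + t).factorial * (k + s + 1).ascFactorial s := by ring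
    _ ≤ (k + s).factorial * (k + s + t).factorial * (k + s + t + 1).ascFactorial s :=
      Nat.mul_le_mul_left _ this
    _ = _ := by ring

lemma powCoeff_le {a : ℕ → ℝ} (hapos : ∀ g : ℕ, 1 ≤ g → 0 < a g) (ha : VolumeRecursion a)
    {p i : ℕ} (hi : 1 ≤ i) (hp : 2 * i ≤ p) :
    powCoeff a p i ≤ bR i * (p.factorial * i.factorial / (p - i).factorial) := by
  rw [powCoeff_eq_sum, bR_eq_sum_range ha hi, Finset.sum_mul]
  refine Finset.sum_le_sum fun k hk => ?_
  have hk : k ≤ i := by simp at hk; omega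
  rw [mul_right_comm]
  refine mul_le_mul_of_nonneg_right ?_ (tupleSum_nonneg hapos _ _)
  rw [Nat.cast_choose ℝ (show k ≤ p by omega), Nat.cast_mul, div_mul_div_comm, one_mul,
    div_le_div_iff₀ (by positivity) (by positivity)]
  have h : ((2 * i - k).factorial * (p - i).factorial : ℝ) ≤
    (p - k).factorial * i.factorial := by exact_mod_cast factorial_mul_factorial_le hk hp
  calc _ = (p.factorial * k.factorial : ℝ) * ((2 * i - k).factorial * (p - i).factorial) := by ring
    _ ≤ (p.factorial * k.factorial : ℝ) * ((p - k).factorial * i.factorial) := by gcongr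
    _ = _ := by ring

lemma powCoeff_two_mul {a : ℕ → ℝ} (ha : VolumeRecursion a) {g : ℕ} (hg : 1 ≤ g) :
    powCoeff a (2 * g) g = (2 * g).factorial * bR g := by
  rw [powCoeff_eq_sum, bR_eq_sum_range ha hg, Finset.mul_sum]
  refine Finset.sum_congr rfl fun k hk => ?_
  have hk : k ≤ g := by simp at hk; omega
  rw [Nat.cast_choose ℝ (show k ≤ 2 * g by omega), Nat.cast_mul]
  ring

lemma mul_powCoeff (a : ℕ → ℝ) (p : ℕ) {m : ℕ} (hm : 1 ≤ m) :
    m * powCoeff a (p + 1) m =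
      (p + 1) * ∑ j ∈ Finset.Icc 1 m, j * ((2 * (j : ℝ) - 1) * a j) * powCoeff a p (m - j) := by
  obtain ⟨n, rfl⟩ := Nat.exists_eq_add_of_le' hm
  have h := congrArg (PowerSeries.coeff n) (PowerSeries.derivative_pow (weightSeries 1 a) (p + 1))
  rw [PowerSeries.coeff_derivative, Nat.add_sub_cancel, mul_assoc,
    ← map_natCast (PowerSeries.C (R := ℝ)), PowerSeries.coeff_C_mul, mul_comm (_ ^ p),
    PowerSeries.coeff_mul, Finset.Nat.sum_antidiagonal_eq_sum_range_succ_mk] at h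
  have h2 : ∀ f : ℕ → ℝ,
      ∑ j ∈ Finset.Icc 1 (n + 1), f j = ∑ j ∈ Finset.range (n + 1), f (j + 1) := by
    intro f
    rw [← Finset.Ico_add_one_right_eq_Icc, Finset.sum_Ico_eq_sum_range]
    simp [add_comm]
  rw [h2, powCoeff]
  push_cast at h ⊢
  rw [mul_comm, h]
  congr 1
  refine Finset.sum_congr rfl fun j _ => ?_
  rw [PowerSeries.coeff_derivative, coeff_weightSeries_of_pos _ _ (by omega), powCoeff]
  push_cast
  ring

lemma sum_volume {a : ℕ → ℝ} (ha : VolumeRecursion a) {g : ℕ} (hg : 1 ≤ g) :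
    ∑ j ∈ Finset.Icc 1 g, j * ((2 * (j : ℝ) - 1) * a j) * powCoeff a (2 * g - 1) (g - j) =
      g * ((2 * g - 1).factorial * bR g) := by
  have h := mul_powCoeff a (2 * g - 1) hg
  have h2 : 2 * g - 1 + 1 = 2 * g := by omega
  have h3 : ((2 * g - 1 : ℕ) : ℝ) + 1 = 2 * g := by exact_mod_cast h2
  have hg' : (0 : ℝ) < g := by exact_mod_cast hg
  have h4 : ((2 * g).factorial : ℝ) = 2 * g * (2 * g - 1).factorial := by
    rw [← Nat.mul_factorial_pred (show 2 * g ≠ 0 by omega)]; push_cast; ring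
  rw [h2, powCoeff_two_mul ha hg, h3, h4] at h
  have : (2 * g : ℝ) ≠ 0 := by positivity
  apply mul_left_cancel₀ this
  rw [← h]; ring

lemma sum_siegelVeech {a d : ℕ → ℝ} (hd : SVRecursion a d) {g : ℕ} (hg : 1 ≤ g) :
    ∑ j ∈ Finset.Icc 1 g, ((2 * (j : ℝ) - 1) * d j) * powCoeff a (2 * g - 1) (g - j) =
      (2 * g - 1).factorial * bR (g - 1) / 2 := by
  rw [mul_div_assoc, hd g hg, Finset.mul_sum]
  refine Finset.sum_congr rfl fun j hj => ?_
  have hj := Finset.mem_Icc.1 hj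
  rw [powCoeff_eq_sum, Finset.mul_sum, Finset.mul_sum]
  refine Finset.sum_congr rfl fun k hk => ?_
  have hk : k ≤ g - j := by simp at hk; omega
  rw [Nat.cast_choose ℝ (show k ≤ 2 * g - 1 by omega), Nat.cast_mul]
  ring

lemma bR_eq_tsum {g : ℕ} (hg : 1 ≤ g) :
    bR g = 2 * (1 / (4 * π ^ 2)) ^ g *
      ((1 - 2 * (1 / 4) ^ g) * ∑' n : ℕ, 1 / (n : ℝ) ^ (2 * g)) := by
  have hs := (hasSum_zeta_nat (k := g) (by omega)).tsum_eq
  have hpos : 0 ≤ ∑' n : ℕ, 1 / (n : ℝ) ^ (2 * g) := tsum_nonneg fun n => by positivity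
  have habs : ∑' n : ℕ, 1 / (n : ℝ) ^ (2 * g) =
      2 ^ (2 * g - 1) * π ^ (2 * g) * |(bernoulli (2 * g) : ℝ)| / (2 * g).factorial := by
    rw [← abs_of_nonneg hpos, hs]
    simp [abs_div, abs_mul, abs_of_pos pi_pos]
  have hb : bR g = (2 ^ (2 * g - 1) - 1) / 2 ^ (2 * g - 1) * |(bernoulli (2 * g) : ℝ)| /
      (2 * g).factorial := by
    rw [bR, bSeq, if_neg (by omega)]
    push_cast
    rfl
  have h2 : (4 : ℝ) ^ g = 2 * 2 ^ (2 * g - 1) := by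
    rw [← pow_succ', show 2 * g - 1 + 1 = 2 * g by omega, pow_mul]; norm_num
  have h3 : (π : ℝ) ^ (2 * g) = (π ^ 2) ^ g := pow_mul _ _ _
  simp only [hb, habs, h3, div_pow, mul_pow, one_pow, h2]
  have := pi_pos
  field_simp

lemma one_le_tsum_zeta {g : ℕ} (hg : 1 ≤ g) : 1 ≤ ∑' n : ℕ, 1 / (n : ℝ) ^ (2 * g) := by
  have hs := (hasSum_zeta_nat (k := g) (by omega)).summable
  have := hs.le_tsum 1 fun j _ => by positivity
  simpa using this

lemma tsum_zeta_le {g : ℕ} (hg : 1 ≤ g) :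
    ∑' n : ℕ, 1 / (n : ℝ) ^ (2 * g) ≤ 1 + 4 * (1 / 4) ^ g := by
  have hs := (hasSum_zeta_nat (k := g) (by omega)).summable
  have hz := hasSum_zeta_two
  rw [hs.tsum_eq_zero_add, ((summable_nat_add_iff 1).2 hs).tsum_eq_zero_add]
  have hz1 := (hasSum_nat_add_iff' 2).2 hz
  have hle : ∀ n : ℕ, 1 / ((n + 1 + 1 : ℕ) : ℝ) ^ (2 * g) ≤
      4 * (1 / 4) ^ g * (1 / ((n + 2 : ℕ) : ℝ) ^ 2) := by
    intro n
    obtain ⟨m, rfl⟩ := Nat.exists_eq_add_of_le' hg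
    have h4 : (4 : ℝ) ^ m ≤ (((n + 2 : ℕ) : ℝ) ^ 2) ^ m := by
      gcongr
      push_cast
      nlinarith [(Nat.cast_nonneg n : (0 : ℝ) ≤ n)]
    have h5 : (4 : ℝ) * (1 / 4) ^ (m + 1) = 1 / 4 ^ m := by
      rw [div_pow, one_pow, pow_succ]; field_simp
    rw [h5, div_mul_div_comm, one_mul, mul_add, pow_add, pow_mul]
    gcongr
  have hsum := Summable.tsum_le_tsum hle ((summable_nat_add_iff 2).2 hs)
    (hz1.summable.mul_left _)
  rw [tsum_mul_left, hz1.tsum_eq] at hsum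
  have hpi : π ^ 2 / 6 - ∑ i ∈ Finset.range 2, 1 / (i : ℝ) ^ 2 ≤ 1 := by
    simp [Finset.sum_range_succ]
    nlinarith [pi_lt_d2, pi_pos]
  have h6 : 4 * (1 / 4 : ℝ) ^ g * (π ^ 2 / 6 - ∑ i ∈ Finset.range 2, 1 / (i : ℝ) ^ 2) ≤
      4 * (1 / 4) ^ g * 1 := by gcongr
  have h7 : (1 : ℝ) / ((0 : ℕ) : ℝ) ^ (2 * g) = 0 := by
    rw [Nat.cast_zero, zero_pow (by omega), div_zero]
  rw [h7]
  simp only [zero_add, Nat.cast_one, one_pow, div_one]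
  linarith

/-- The ratio of `b_g` to its leading asymptotic `2 / (2 π) ^ (2 g)`. -/
def bRatio (g : ℕ) : ℝ := bR g / (2 * (1 / (4 * π ^ 2)) ^ g)

lemma bR_eq_bRatio (g : ℕ) : bR g = 2 * (1 / (4 * π ^ 2)) ^ g * bRatio g := by
  have := pi_pos
  rw [bRatio, mul_div_cancel₀ _ (by positivity)]

lemma abs_bRatio_sub_one_le {g : ℕ} (hg : 1 ≤ g) : |bRatio g - 1| ≤ 4 * (1 / 4) ^ g := by
  have hpi := pi_pos
  have h1 := one_le_tsum_zeta hg
  have h2 := tsum_zeta_le hg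
  have h4 : (1 / 4 : ℝ) ^ g ≤ 1 / 4 := by
    simpa using pow_le_pow_of_le_one (by norm_num : (0 : ℝ) ≤ 1 / 4) (by norm_num) hg
  have h0 : (0 : ℝ) < (1 / 4) ^ g := by positivity
  have he : bRatio g = (1 - 2 * (1 / 4) ^ g) * ∑' n : ℕ, 1 / (n : ℝ) ^ (2 * g) := by
    rw [bRatio, bR_eq_tsum hg, mul_div_cancel_left₀ _ (by positivity)]
  rw [he, abs_le]
  constructor <;> nlinarith

lemma half_le_bRatio {g : ℕ} (hg : 1 ≤ g) : 1 / 2 ≤ bRatio g := by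
  have hpi := pi_pos
  have h1 := one_le_tsum_zeta hg
  have h4 : (1 / 4 : ℝ) ^ g ≤ 1 / 4 := by
    simpa using pow_le_pow_of_le_one (by norm_num : (0 : ℝ) ≤ 1 / 4) (by norm_num) hg
  rw [bRatio, bR_eq_tsum hg, mul_div_cancel_left₀ _ (by positivity)]
  nlinarith

lemma bRatio_le_two {g : ℕ} (hg : 1 ≤ g) : bRatio g ≤ 2 := by
  have h4 : (1 / 4 : ℝ) ^ g ≤ 1 / 4 := by
    simpa using pow_le_pow_of_le_one (by norm_num : (0 : ℝ) ≤ 1 / 4) (by norm_num) hg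
  have := (abs_le.1 (abs_bRatio_sub_one_le hg)).2
  linarith

lemma bR_pos {g : ℕ} (hg : 1 ≤ g) : 0 < bR g := by
  have := pi_pos
  have := half_le_bRatio hg
  rw [bR_eq_bRatio]
  positivity

lemma bR_mul_bR_le {i j : ℕ} (hi : 1 ≤ i) (hj : 1 ≤ j) : bR i * bR j ≤ 16 * bR (i + j) := by
  have hpi := pi_pos
  have h1 := half_le_bRatio (g := i + j) (by omega)
  have h2 := bRatio_le_two hi
  have h3 := bRatio_le_two hj
  have h4 := half_le_bRatio hj
  rw [bR_eq_bRatio, bR_eq_bRatio, bR_eq_bRatio, pow_add]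
  set x := (1 / (4 * π ^ 2)) ^ i
  set y := (1 / (4 * π ^ 2)) ^ j
  have hx : 0 < x := by positivity
  have hy : 0 < y := by positivity
  have : bRatio i * bRatio j ≤ 8 * bRatio (i + j) := by nlinarith
  calc _ = (4 * (x * y)) * (bRatio i * bRatio j) := by ring
    _ ≤ (4 * (x * y)) * (8 * bRatio (i + j)) := by gcongr
    _ = _ := by ring

lemma bR_le_succ {g : ℕ} (hg : 1 ≤ g) : bR g ≤ 160 * bR (g + 1) := by
  have hpi := pi_pos
  have h1 := half_le_bRatio (g := g + 1) (by omega)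
  have h2 := bRatio_le_two hg
  have hpi2 : π ^ 2 ≤ 10 := by nlinarith [pi_lt_d2]
  rw [bR_eq_bRatio g, bR_eq_bRatio (g + 1), pow_succ (1 / (4 * π ^ 2))]
  set x := (1 / (4 * π ^ 2)) ^ g
  have hx : 0 < x := by positivity
  have h3 : 1 / 40 ≤ 1 / (4 * π ^ 2) := by gcongr; linarith
  calc 2 * x * bRatio g ≤ 2 * x * 2 := by gcongr
    _ = 160 * (2 * (x * (1 / 40)) * (1 / 2)) := by ring
    _ ≤ _ := by gcongr

lemma choose_le_choose_of_add_le {s : ℕ} : ∀ {n r : ℕ}, s ≤ r → s + r ≤ n →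
    n.choose s ≤ n.choose r := by
  induction s with
  | zero =>
    intro n r _ h
    rw [Nat.choose_zero_right]
    exact Nat.choose_pos (by omega)
  | succ s ih =>
    intro n
    induction n with
    | zero => intro r _ h; omega
    | succ n ihn =>
      intro r hr hn
      obtain ⟨r, rfl⟩ := Nat.exists_eq_add_of_le' (show 1 ≤ r by omega)
      rcases (show s + 1 + (r + 1) = n + 1 ∨ s + 1 + (r + 1) ≤ n by omega) with h | h
      · exact (Nat.choose_symm_of_eq_add h.symm).le
      · rw [Nat.choose_succ_succ, Nat.choose_succ_succ]
        exact Nat.add_le_add (ih (by omega) (by omega)) (ihn hr h)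

lemma sum_Icc_one_eq {M : Type*} [AddCommMonoid M] (F : ℕ → M) {g : ℕ} (hg : 4 ≤ g) :
    ∑ j ∈ Finset.Icc 1 g, F j = F 1 + ∑ j ∈ Finset.Icc 2 (g - 2), F j + F (g - 1) + F g := by
  obtain ⟨n, rfl⟩ := Nat.exists_eq_add_of_le' hg
  rw [Finset.sum_Icc_succ_top (by omega), Finset.sum_Icc_succ_top (by omega),
    ← Finset.add_sum_Ioc_eq_sum_Icc (show 1 ≤ n + 2 by omega)]
  rfl

lemma sum_one_div_choose_le {g : ℕ} (hg : 4 ≤ g) :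
    ∑ j ∈ Finset.Icc 2 (g - 2), 1 / ((g + j - 1).choose (2 * j - 1) : ℝ) ≤ 14 / (g : ℝ) ^ 2 := by
  have hg' : (4 : ℝ) ≤ g := by exact_mod_cast hg
  have hpos : (0 : ℝ) < g := by linarith
  have hterm : ∀ j ∈ Finset.Icc 2 (g - 2), 1 / ((g + j - 1).choose (2 * j - 1) : ℝ) ≤
      12 / (g : ℝ) ^ 3 + if j = g - 2 then 2 / (g : ℝ) ^ 2 else 0 := by
    intro j hj
    have hj := Finset.mem_Icc.1 hj
    split_ifs with h
    · have h1 : (2 * g - 3).choose 2 = (g + j - 1).choose (2 * j - 1) := by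
        subst h
        rw [← Nat.choose_symm (by omega)]
        congr 1 <;> omega
      have h2 : ((2 * g - 3 : ℕ) : ℝ) = 2 * g - 3 := by
        rw [Nat.cast_sub (by omega)]; push_cast; ring
      rw [← h1, Nat.cast_choose_two, h2]
      have : 1 / ((2 * (g : ℝ) - 3) * (2 * g - 3 - 1) / 2) ≤ 2 / (g : ℝ) ^ 2 := by
        rw [div_le_div_iff₀ (by nlinarith) (by positivity)]
        nlinarith
      have : (0 : ℝ) ≤ 12 / (g : ℝ) ^ 3 := by positivity
      linarith
    · have h1 : (g + 1).choose 3 ≤ (g + j - 1).choose (2 * j - 1) :=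
        (Nat.choose_le_choose 3 (by omega)).trans
          (choose_le_choose_of_add_le (by omega) (by omega))
      have h2 : ((g + 1).choose 3 : ℝ) = (g + 1) * g * (g - 1) / 6 := by
        obtain ⟨n, rfl⟩ := Nat.exists_eq_add_of_le' hg
        rw [Nat.cast_choose_eq_ascPochhammer_div]
        simp [ascPochhammer_succ_right, Nat.factorial]
        ring
      have h3 : (g : ℝ) ^ 3 / 12 ≤ (g + j - 1).choose (2 * j - 1) := by
        refine le_trans ?_ (Nat.cast_le.2 h1)
        rw [h2]
        nlinarith [mul_pos hpos hpos]
      rw [add_zero]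
      calc _ ≤ 1 / ((g : ℝ) ^ 3 / 12) := by gcongr
        _ = _ := by field_simp
  refine (Finset.sum_le_sum hterm).trans ?_
  rw [Finset.sum_add_distrib, Finset.sum_const, Finset.sum_ite_eq', if_pos (by simp; omega),
    Nat.card_Icc, nsmul_eq_mul]
  have h1 : ((g - 2 + 1 - 2 : ℕ) : ℝ) ≤ g := by exact_mod_cast (by omega)
  calc _ ≤ (g : ℝ) * (12 / (g : ℝ) ^ 3) + 2 / (g : ℝ) ^ 2 := by gcongr
    _ = _ := by field_simp; norm_num

lemma sum_one_div_choose_two_mul_le {m : ℕ} (hm : 2 ≤ m) :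
    ∑ j ∈ Finset.Icc 1 (m - 1), 1 / ((m + j).choose (2 * j) : ℝ) ≤ 3 / (m : ℝ) := by
  have hm' : (2 : ℝ) ≤ m := by exact_mod_cast hm
  have hpos : (0 : ℝ) < m := by linarith
  have hterm : ∀ j ∈ Finset.Icc 1 (m - 1), 1 / ((m + j).choose (2 * j) : ℝ) ≤
      2 / (m : ℝ) ^ 2 + if j = m - 1 then 1 / (m : ℝ) else 0 := by
    intro j hj
    have hj := Finset.mem_Icc.1 hj
    split_ifs with h
    · have h1 : m ≤ (m + j).choose (2 * j) := by
        have : (m + j).choose (2 * j) = m + j := by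
          rw [← Nat.choose_symm (by omega), show m + j - 2 * j = 1 by omega, Nat.choose_one_right]
        omega
      have : (0 : ℝ) ≤ 2 / (m : ℝ) ^ 2 := by positivity
      have : 1 / ((m + j).choose (2 * j) : ℝ) ≤ 1 / m := by gcongr
      linarith
    · have h1 : (m + 1).choose 2 ≤ (m + j).choose (2 * j) :=
        (Nat.choose_le_choose 2 (by omega)).trans
          (choose_le_choose_of_add_le (by omega) (by omega))
      have h3 : (m : ℝ) ^ 2 / 2 ≤ (m + j).choose (2 * j) := by
        refine le_trans ?_ (Nat.cast_le.2 h1)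
        rw [Nat.cast_choose_two]
        push_cast
        nlinarith
      rw [add_zero]
      calc _ ≤ 1 / ((m : ℝ) ^ 2 / 2) := by gcongr
        _ = _ := by field_simp
  refine (Finset.sum_le_sum hterm).trans ?_
  rw [Finset.sum_add_distrib, Finset.sum_const, Finset.sum_ite_eq', if_pos (by simp; omega),
    Nat.card_Icc, nsmul_eq_mul]
  have h1 : ((m - 1 + 1 - 1 : ℕ) : ℝ) ≤ m := by exact_mod_cast (by omega)
  calc _ ≤ (m : ℝ) * (2 / (m : ℝ) ^ 2) + 1 / (m : ℝ) := by gcongr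
    _ = _ := by field_simp; norm_num

/-- The normalization `(2 g - 1)! b_g`, the leading asymptotic of `(2 g - 1) a_g`. -/
def normSeq (g : ℕ) : ℝ := (2 * g - 1).factorial * bR g

lemma normSeq_pos {g : ℕ} (hg : 1 ≤ g) : 0 < normSeq g :=
  mul_pos (by positivity) (bR_pos hg)

section Bounds

variable {a d : ℕ → ℝ}

lemma weight_pos {f : ℕ → ℝ} (hf : ∀ g : ℕ, 1 ≤ g → 0 < f g) {g : ℕ} (hg : 1 ≤ g) :
    0 < (2 * (g : ℝ) - 1) * f g := by
  have : (1 : ℝ) ≤ g := by exact_mod_cast hg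
  exact mul_pos (by linarith) (hf g hg)

lemma weight_le_normSeq (hapos : ∀ g : ℕ, 1 ≤ g → 0 < a g) (ha : VolumeRecursion a) {g : ℕ}
    (hg : 1 ≤ g) : (2 * (g : ℝ) - 1) * a g ≤ normSeq g := by
  have hg' : (0 : ℝ) < g := by exact_mod_cast hg
  have h := Finset.single_le_sum (f := fun j : ℕ =>
      j * ((2 * (j : ℝ) - 1) * a j) * powCoeff a (2 * g - 1) (g - j)) (s := Finset.Icc 1 g)
    (fun j hj => mul_nonneg (mul_nonneg (Nat.cast_nonneg _)
      (weight_pos hapos (Finset.mem_Icc.1 hj).1).le) (powCoeff_nonneg hapos _ _))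
    (Finset.mem_Icc.2 ⟨hg, le_rfl⟩)
  rw [sum_volume ha hg] at h
  simp only [Nat.sub_self, powCoeff_zero, mul_one] at h
  exact le_of_mul_le_mul_left h hg'

lemma weight_le_of_siegelVeech (hapos : ∀ g : ℕ, 1 ≤ g → 0 < a g)
    (hdpos : ∀ g : ℕ, 1 ≤ g → 0 < d g) (hd : SVRecursion a d) {g : ℕ}
    (hg : 2 ≤ g) : (2 * (g : ℝ) - 1) * d g ≤ 80 * normSeq g := by
  have h := Finset.single_le_sum (f := fun j : ℕ =>
      ((2 * (j : ℝ) - 1) * d j) * powCoeff a (2 * g - 1) (g - j)) (s := Finset.Icc 1 g)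
    (fun j hj => mul_nonneg (weight_pos hdpos (Finset.mem_Icc.1 hj).1).le
      (powCoeff_nonneg hapos _ _)) (Finset.mem_Icc.2 ⟨by omega, le_rfl⟩)
  rw [sum_siegelVeech hd (by omega)] at h
  simp only [Nat.sub_self, powCoeff_zero, mul_one] at h
  have hb := bR_le_succ (g := g - 1) (by omega)
  rw [Nat.sub_add_cancel (by omega)] at hb
  refine h.trans ?_
  rw [normSeq]
  have : (0 : ℝ) < (2 * g - 1).factorial := by positivity
  nlinarith

lemma normSeq_mul_powCoeff_le (hapos : ∀ g : ℕ, 1 ≤ g → 0 < a g) (ha : VolumeRecursion a)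
    {g j : ℕ} (hj : 1 ≤ j) (hjg : j < g) :
    normSeq j * powCoeff a (2 * g - 1) (g - j) ≤
      16 * normSeq g * (1 / ((g + j - 1).choose (2 * j - 1) : ℝ)) := by
  have hP := powCoeff_le hapos ha (p := 2 * g - 1) (i := g - j) (by omega) (by omega)
  have hb := bR_mul_bR_le hj (show 1 ≤ g - j by omega)
  rw [Nat.add_sub_cancel' hjg.le] at hb
  rw [Nat.cast_choose ℝ (by omega), show g + j - 1 - (2 * j - 1) = g - j by omega, one_div_div]
  rw [show 2 * g - 1 - (g - j) = g + j - 1 by omega] at hP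
  calc _ ≤ normSeq j *
        (bR (g - j) * ((2 * g - 1).factorial * (g - j).factorial / (g + j - 1).factorial)) :=
        mul_le_mul_of_nonneg_left hP (normSeq_pos hj).le
    _ = (bR j * bR (g - j)) * ((2 * j - 1).factorial *
        ((2 * g - 1).factorial * (g - j).factorial / (g + j - 1).factorial)) := by
        rw [normSeq]; ring
    _ ≤ (16 * bR g) * ((2 * j - 1).factorial *
        ((2 * g - 1).factorial * (g - j).factorial / (g + j - 1).factorial)) := by gcongr
    _ = _ := by rw [normSeq]; ring

lemma normSeq_mul_powCoeff_two_mul_le (hapos : ∀ g : ℕ, 1 ≤ g → 0 < a g)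
    (ha : VolumeRecursion a) {m j : ℕ} (hj : 1 ≤ j) (hjm : j < m) :
    j * (normSeq j * powCoeff a (2 * m) (m - j)) ≤
      m * (16 * normSeq m * (1 / ((m + j).choose (2 * j) : ℝ))) := by
  have hP := powCoeff_le hapos ha (p := 2 * m) (i := m - j) (by omega) (by omega)
  have hb := bR_mul_bR_le hj (show 1 ≤ m - j by omega)
  rw [Nat.add_sub_cancel' hjm.le] at hb
  rw [Nat.cast_choose ℝ (by omega), show m + j - 2 * j = m - j by omega, one_div_div]
  rw [show 2 * m - (m - j) = m + j by omega] at hP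
  have h4 : ∀ n : ℕ, 1 ≤ n → ((2 * n).factorial : ℝ) = 2 * n * (2 * n - 1).factorial := by
    intro n hn
    rw [← Nat.mul_factorial_pred (show 2 * n ≠ 0 by omega)]; push_cast; ring
  calc _ ≤ j * (normSeq j *
        (bR (m - j) * ((2 * m).factorial * (m - j).factorial / (m + j).factorial))) := by
        gcongr
        exact (normSeq_pos hj).le
    _ = (bR j * bR (m - j)) * (j * (2 * j - 1).factorial *
        ((2 * m).factorial * (m - j).factorial / (m + j).factorial)) := by
        rw [normSeq]; ring
    _ ≤ (16 * bR m) * (j * (2 * j - 1).factorial *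
        ((2 * m).factorial * (m - j).factorial / (m + j).factorial)) := by gcongr
    _ = _ := by rw [normSeq, h4 m (by omega), h4 j hj]; ring

lemma tail_le (hapos : ∀ g : ℕ, 1 ≤ g → 0 < a g) (ha : VolumeRecursion a) {f : ℕ → ℝ} {K : ℝ}
    (hK : 0 ≤ K) {g : ℕ} (hg : 4 ≤ g)
    (hf : ∀ j ∈ Finset.Icc 2 (g - 2), f j ≤ K * normSeq j) :
    ∑ j ∈ Finset.Icc 2 (g - 2), f j * powCoeff a (2 * g - 1) (g - j) ≤
      224 * K * normSeq g / (g : ℝ) ^ 2 := by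
  have hN := normSeq_pos (g := g) (by omega)
  calc _ ≤ ∑ j ∈ Finset.Icc 2 (g - 2),
        16 * K * normSeq g * (1 / ((g + j - 1).choose (2 * j - 1) : ℝ)) := by
        refine Finset.sum_le_sum fun j hj => ?_
        have hj' := Finset.mem_Icc.1 hj
        have h := normSeq_mul_powCoeff_le hapos ha (g := g) (j := j) (by omega) (by omega)
        calc _ ≤ K * normSeq j * powCoeff a (2 * g - 1) (g - j) :=
              mul_le_mul_of_nonneg_right (hf j hj) (powCoeff_nonneg hapos _ _)
          _ = K * (normSeq j * powCoeff a (2 * g - 1) (g - j)) := by ring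
          _ ≤ K * (16 * normSeq g * (1 / ((g + j - 1).choose (2 * j - 1) : ℝ))) := by gcongr
          _ = _ := by ring
    _ ≤ 16 * K * normSeq g * (14 / (g : ℝ) ^ 2) := by
        rw [← Finset.mul_sum]
        gcongr
        exact sum_one_div_choose_le hg
    _ = _ := by ring

lemma first_term_volume (ha : VolumeRecursion a) : a 1 = 1 / 24 := by
  have h := sum_volume ha le_rfl
  have hb : bR 1 = 1 / 24 := by
    rw [bR, bSeq, if_neg one_ne_zero, mul_one, bernoulli_two]
    norm_num [Nat.factorial, abs_of_pos]
  simp [powCoeff_zero, hb] at h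
  linarith

lemma first_term_siegelVeech (hd : SVRecursion a d) : d 1 = 1 / 2 := by
  have h := sum_siegelVeech hd le_rfl
  simp [powCoeff_zero, bR, bSeq] at h
  linarith

/-- The ratio of `(2 g - 1) f_g` to `(2 g - 1)! b_g`. -/
def normalized (f : ℕ → ℝ) (g : ℕ) : ℝ := (2 * (g : ℝ) - 1) * f g / normSeq g

/-- The ratio of consecutive normalizations, weighted by `2 g - 1`. -/
def stepRatio (g : ℕ) : ℝ := (2 * (g : ℝ) - 1) * normSeq (g - 1) / normSeq g

lemma normalized_mul_normSeq (f : ℕ → ℝ) {g : ℕ} (hg : 1 ≤ g) :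
    normalized f g * normSeq g = (2 * (g : ℝ) - 1) * f g :=
  div_mul_cancel₀ _ (normSeq_pos hg).ne'

lemma stepRatio_mul_normSeq {g : ℕ} (hg : 1 ≤ g) :
    stepRatio g * normSeq g = (2 * (g : ℝ) - 1) * normSeq (g - 1) :=
  div_mul_cancel₀ _ (normSeq_pos hg).ne'

lemma cast_two_mul_sub_one {g : ℕ} (hg : 1 ≤ g) : ((2 * g - 1 : ℕ) : ℝ) = 2 * g - 1 := by
  rw [Nat.cast_sub (by omega)]; push_cast; ring

lemma abs_normalized_volume_sub_le (hapos : ∀ g : ℕ, 1 ≤ g → 0 < a g) (ha : VolumeRecursion a)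
    {g : ℕ} (hg : 4 ≤ g) :
    |normalized a g - (1 - (1 - 1 / (g : ℝ)) * (1 / 24) * stepRatio g * normalized a (g - 1))| ≤
      240 / (g : ℝ) ^ 2 := by
  have hN := normSeq_pos (g := g) (by omega)
  have hg' : (0 : ℝ) < g := by exact_mod_cast (by omega : 0 < g)
  have h := sum_volume ha (g := g) (by omega)
  rw [sum_Icc_one_eq _ hg, Nat.sub_self, powCoeff_zero, Nat.sub_sub_self (by omega), powCoeff_one,
    cast_two_mul_sub_one (by omega), ← normalized_mul_normSeq a (show 1 ≤ g - 1 by omega),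
    ← normalized_mul_normSeq a (show 1 ≤ g by omega), Nat.cast_sub (show 1 ≤ g by omega),
    first_term_volume ha] at h
  change _ = g * normSeq g at h
  have hs := stepRatio_mul_normSeq (g := g) (by omega)
  have hfirst := normSeq_mul_powCoeff_le hapos ha (g := g) (j := 1) le_rfl (by omega)
  have hN1 := weight_le_normSeq hapos ha (g := 1) le_rfl
  rw [first_term_volume ha] at hN1
  have hP := powCoeff_nonneg hapos (2 * g - 1) (g - 1)
  rw [Nat.add_sub_cancel, mul_one, show 2 - 1 = 1 from rfl, Nat.choose_one_right] at hfirst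
  have htail := tail_le hapos ha (f := fun j => j * ((2 * (j : ℝ) - 1) * a j)) (K := g)
    hg'.le hg fun j hj => by
      have hj := Finset.mem_Icc.1 hj
      have : (j : ℝ) ≤ g := by exact_mod_cast (by omega)
      exact mul_le_mul this (weight_le_normSeq hapos ha (by omega))
        (weight_pos hapos (by omega)).le hg'.le
  have hnn : 0 ≤ ∑ j ∈ Finset.Icc 2 (g - 2), j * ((2 * (j : ℝ) - 1) * a j) *
      powCoeff a (2 * g - 1) (g - j) :=
    Finset.sum_nonneg fun j hj => mul_nonneg (mul_nonneg (Nat.cast_nonneg _)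
      (weight_pos hapos (by have := Finset.mem_Icc.1 hj; omega)).le) (powCoeff_nonneg hapos _ _)
  set T := ∑ j ∈ Finset.Icc 2 (g - 2), j * ((2 * (j : ℝ) - 1) * a j) *
      powCoeff a (2 * g - 1) (g - j)
  set P := powCoeff a (2 * g - 1) (g - 1)
  have hfirst' : 1 / 24 * P ≤ 16 * normSeq g * (1 / g) := by
    refine le_trans ?_ hfirst
    refine mul_le_mul_of_nonneg_right ?_ hP
    norm_num at hN1
    linarith
  have key : (normalized a g -
      (1 - (1 - 1 / (g : ℝ)) * (1 / 24) * stepRatio g * normalized a (g - 1))) =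
      -((1 / 24 * P + T) / (g * normSeq g)) := by
    have hsub : (normalized a g -
        (1 - (1 - 1 / (g : ℝ)) * (1 / 24) * stepRatio g * normalized a (g - 1))) * (g * normSeq g)
        = normalized a g * (g * normSeq g) - g * normSeq g + (g - 1) * (1 / 24) *
          (stepRatio g * normSeq g) * normalized a (g - 1) := by
      field_simp
      ring
    rw [← neg_div, eq_div_iff (by positivity), hsub, hs]
    push_cast at h
    linarith
  rw [key, abs_neg, abs_of_nonneg (by positivity), div_le_iff₀ (by positivity)]
  calc 1 / 24 * P + T ≤ 16 * normSeq g * (1 / g) + 224 * g * normSeq g / (g : ℝ) ^ 2 :=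
        add_le_add hfirst' htail
    _ = _ := by field_simp; norm_num

/-- The relative error of `(2 m + 1) (2 m - 1) a_m` as an approximation of
`powCoeff a (2 * m + 1) m`. -/
def powCoeffError (a : ℕ → ℝ) (m : ℕ) : ℝ :=
  powCoeff a (2 * m + 1) m / ((2 * m + 1) * normSeq m) - normalized a m

lemma abs_powCoeffError_le (hapos : ∀ g : ℕ, 1 ≤ g → 0 < a g) (ha : VolumeRecursion a)
    {m : ℕ} (hm : 2 ≤ m) : |powCoeffError a m| ≤ 48 / (m : ℝ) := by
  have hN := normSeq_pos (g := m) (by omega)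
  have hm' : (0 : ℝ) < m := by exact_mod_cast (by omega : 0 < m)
  have h := mul_powCoeff a (2 * m) (m := m) (by omega)
  have hsplit : ∀ F : ℕ → ℝ, ∑ j ∈ Finset.Icc 1 m, F j = ∑ j ∈ Finset.Icc 1 (m - 1), F j + F m := by
    intro F
    obtain ⟨n, rfl⟩ := Nat.exists_eq_add_of_le' (show 1 ≤ m by omega)
    rw [Finset.sum_Icc_succ_top (by omega)]
    rfl
  rw [hsplit, Nat.sub_self, powCoeff_zero,
    ← normalized_mul_normSeq a (show 1 ≤ m by omega)] at h
  have hnn : 0 ≤ ∑ j ∈ Finset.Icc 1 (m - 1), j * ((2 * (j : ℝ) - 1) * a j) *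
      powCoeff a (2 * m) (m - j) :=
    Finset.sum_nonneg fun j hj => mul_nonneg (mul_nonneg (Nat.cast_nonneg _)
      (weight_pos hapos (by have := Finset.mem_Icc.1 hj; omega)).le) (powCoeff_nonneg hapos _ _)
  have hle : ∑ j ∈ Finset.Icc 1 (m - 1), j * ((2 * (j : ℝ) - 1) * a j) *
      powCoeff a (2 * m) (m - j) ≤ 16 * m * normSeq m * (3 / m) := by
    calc _ ≤ ∑ j ∈ Finset.Icc 1 (m - 1),
          16 * m * normSeq m * (1 / ((m + j).choose (2 * j) : ℝ)) := by
          refine Finset.sum_le_sum fun j hj => ?_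
          have hj := Finset.mem_Icc.1 hj
          have h := normSeq_mul_powCoeff_two_mul_le hapos ha (m := m) (j := j) (by omega) (by omega)
          have h1 := mul_le_mul_of_nonneg_left (mul_le_mul_of_nonneg_right
            (weight_le_normSeq hapos ha hj.1) (powCoeff_nonneg hapos (2 * m) (m - j)))
            (Nat.cast_nonneg (α := ℝ) j)
          linarith
      _ ≤ _ := by
          rw [← Finset.mul_sum]
          gcongr
          exact sum_one_div_choose_two_mul_le hm
  set T := ∑ j ∈ Finset.Icc 1 (m - 1), j * ((2 * (j : ℝ) - 1) * a j) *
      powCoeff a (2 * m) (m - j)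
  push_cast at h
  have key : powCoeffError a m = T / (m * normSeq m) := by
    rw [powCoeffError, sub_eq_iff_eq_add, div_eq_iff (by positivity)]
    apply mul_left_cancel₀ hm'.ne'
    rw [h]
    field_simp
  rw [key, abs_of_nonneg (by positivity), div_le_iff₀ (by positivity)]
  calc T ≤ _ := hle
    _ = _ := by ring

lemma abs_normalized_siegelVeech_sub_le (hapos : ∀ g : ℕ, 1 ≤ g → 0 < a g)
    (hdpos : ∀ g : ℕ, 1 ≤ g → 0 < d g) (ha : VolumeRecursion a) (hd : SVRecursion a d)
    {g : ℕ} (hg : 4 ≤ g) :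
    |normalized d g - (bR (g - 1) / bR g / 2 - 1 / 24 * stepRatio g * normalized d (g - 1) -
      1 / 2 * stepRatio g * (normalized a (g - 1) + powCoeffError a (g - 1)))| ≤
      17920 / (g : ℝ) ^ 2 := by
  have hN := normSeq_pos (g := g) (by omega)
  have hN1 := normSeq_pos (g := g - 1) (by omega)
  have hg' : (4 : ℝ) ≤ g := by exact_mod_cast hg
  have h := sum_siegelVeech hd (g := g) (by omega)
  have hr : (2 * g - 1).factorial * bR (g - 1) / 2 = bR (g - 1) / bR g / 2 * normSeq g := by
    have := bR_pos (g := g) (by omega)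
    rw [normSeq]; field_simp
  have hQ : powCoeff a (2 * g - 1) (g - 1) =
      (normalized a (g - 1) + powCoeffError a (g - 1)) * (stepRatio g * normSeq g) := by
    have h2 : 2 * (g - 1) + 1 = 2 * g - 1 := by omega
    have h3 : 2 * ((g - 1 : ℕ) : ℝ) + 1 = 2 * g - 1 := by
      rw [Nat.cast_sub (by omega)]; push_cast; ring
    have : 2 * (g : ℝ) - 1 ≠ 0 := by linarith
    rw [stepRatio_mul_normSeq (by omega), powCoeffError, h2, h3]
    field_simp
    ring
  rw [sum_Icc_one_eq _ hg, Nat.sub_self, powCoeff_zero, Nat.sub_sub_self (by omega), powCoeff_one,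
    cast_two_mul_sub_one (by omega), ← normalized_mul_normSeq d (show 1 ≤ g - 1 by omega),
    ← normalized_mul_normSeq d (show 1 ≤ g by omega),
    first_term_volume ha, first_term_siegelVeech hd, hr, hQ] at h
  have hs := stepRatio_mul_normSeq (g := g) (by omega)
  have htail := tail_le hapos ha (f := fun j => (2 * (j : ℝ) - 1) * d j) (K := 80)
    (by norm_num) hg fun j hj =>
      weight_le_of_siegelVeech hapos hdpos hd (Finset.mem_Icc.1 hj).1
  have hnn : 0 ≤ ∑ j ∈ Finset.Icc 2 (g - 2), (2 * (j : ℝ) - 1) * d j *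
      powCoeff a (2 * g - 1) (g - j) :=
    Finset.sum_nonneg fun j hj => mul_nonneg
      (weight_pos hdpos (by have := Finset.mem_Icc.1 hj; omega)).le (powCoeff_nonneg hapos _ _)
  set T := ∑ j ∈ Finset.Icc 2 (g - 2), (2 * (j : ℝ) - 1) * d j *
      powCoeff a (2 * g - 1) (g - j)
  have key : (normalized d g -
      (bR (g - 1) / bR g / 2 - 1 / 24 * stepRatio g * normalized d (g - 1) -
      1 / 2 * stepRatio g * (normalized a (g - 1) + powCoeffError a (g - 1)))) =
      -(T / normSeq g) := by
    rw [← neg_div, eq_div_iff hN.ne']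
    have h5 : normalized d (g - 1) * normSeq (g - 1) * ((2 * g - 1) * (1 / 24)) =
      1 / 24 * (stepRatio g * normSeq g) * normalized d (g - 1) := by rw [hs]; ring
    rw [h5] at h
    push_cast at h
    linarith
  rw [key, abs_neg, abs_of_nonneg (by positivity), div_le_iff₀ (by positivity)]
  calc T ≤ _ := htail
    _ = _ := by ring

end Bounds

section Asymptotics

open Filter Asymptotics Topology

lemma abs_bR_ratio_sub_le {g : ℕ} (hg : 2 ≤ g) :
    |bR (g - 1) / bR g - 4 * π ^ 2| ≤ 160 * π ^ 2 / (g : ℝ) ^ 2 := by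
  have hpi := pi_pos
  obtain ⟨n, rfl⟩ := Nat.exists_eq_add_of_le' (show 1 ≤ g by omega)
  have h1 := abs_bRatio_sub_one_le (g := n) (by omega)
  have h2 := abs_bRatio_sub_one_le (g := n + 1) (by omega)
  have h3 := half_le_bRatio (g := n + 1) (by omega)
  have h4 : (1 / 4 : ℝ) ^ (n + 1) ≤ 1 / ((n + 1 : ℕ) : ℝ) ^ 2 := by
    have h5 : ((n + 1 : ℕ) : ℝ) ≤ 2 ^ (n + 1) := by exact_mod_cast Nat.lt_two_pow_self.le
    have h6 : (4 : ℝ) ^ (n + 1) = (2 ^ (n + 1)) ^ 2 := by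
      rw [← pow_mul, mul_comm, pow_mul]; norm_num
    rw [div_pow, one_pow, h6]
    gcongr
  have key : bR n / bR (n + 1) - 4 * π ^ 2 =
      4 * π ^ 2 * (((bRatio n - 1) - (bRatio (n + 1) - 1)) / bRatio (n + 1)) := by
    rw [bR_eq_bRatio n, bR_eq_bRatio (n + 1), pow_succ (1 / (4 * π ^ 2))]
    field_simp
    ring
  rw [Nat.add_sub_cancel, key, abs_mul, abs_of_pos (by positivity), abs_div,
    abs_of_pos (show 0 < bRatio (n + 1) by linarith)]
  have h5 : |(bRatio n - 1) - (bRatio (n + 1) - 1)| ≤ 20 * (1 / 4) ^ (n + 1) := by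
    refine (abs_sub _ _).trans ?_
    rw [pow_succ] at h2 ⊢
    linarith
  calc _ ≤ 4 * π ^ 2 * (20 * (1 / 4) ^ (n + 1) / (1 / 2)) := by gcongr
    _ ≤ 4 * π ^ 2 * (20 * (1 / ((n + 1 : ℕ) : ℝ) ^ 2) / (1 / 2)) := by gcongr
    _ = _ := by ring

lemma stepRatio_eq {g : ℕ} (hg : 2 ≤ g) :
    stepRatio g = bR (g - 1) / bR g * (1 / (2 * ((g : ℝ) - 1))) := by
  have hb := bR_pos (g := g) (by omega)
  obtain ⟨n, rfl⟩ := Nat.exists_eq_add_of_le' hg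
  have h1 : 2 * (n + 2) - 1 = (2 * n + 1) + 1 + 1 := by omega
  have h2 : 2 * (n + 2 - 1) - 1 = 2 * n + 1 := by omega
  rw [stepRatio, normSeq, normSeq, h1, h2, Nat.factorial_succ (2 * n + 1 + 1),
    Nat.factorial_succ (2 * n + 1)]
  have h3 : ((2 * n + 1).factorial : ℝ) ≠ 0 := by positivity
  push_cast
  have h4 : (2 : ℝ) * (n + 2) - 1 = 2 * n + 1 + 1 + 1 := by ring
  have h5 : (n : ℝ) + 2 - 1 = n + 1 := by ring
  rw [h4, h5]
  field_simp
  ring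

lemma isBigO_of_abs_le {f h : ℕ → ℝ} {C : ℝ} {n : ℕ} (hfh : ∀ g, n ≤ g → |f g| ≤ C * h g) :
    f =O[atTop] h := by
  refine IsBigO.of_bound |C| ?_
  filter_upwards [eventually_ge_atTop n] with g hg
  rw [norm_eq_abs, norm_eq_abs, ← abs_mul]
  exact (hfh g hg).trans (le_abs_self _)

lemma one_div_sq_isBigO :
    (fun g : ℕ => 1 / (g : ℝ) ^ 2) =O[atTop] fun g : ℕ => 1 / (g : ℝ) := by
  refine isBigO_of_abs_le (C := 1) (n := 1) fun g hg => ?_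
  have hg' : (1 : ℝ) ≤ g := by exact_mod_cast hg
  rw [abs_of_nonneg (by positivity), one_mul]
  gcongr
  nlinarith

lemma one_div_mul_isBigO {f h : ℕ → ℝ} (hf : f =O[atTop] fun g : ℕ => 1 / (g : ℝ))
    (hh : h =O[atTop] fun g : ℕ => 1 / (g : ℝ)) :
    (fun g => f g * h g) =O[atTop] fun g : ℕ => 1 / (g : ℝ) ^ 2 :=
  (hf.mul hh).congr_right fun g => by rw [div_mul_div_comm, one_mul, sq]

lemma isBigO_pred {f : ℕ → ℝ} (hf : f =O[atTop] fun g : ℕ => 1 / (g : ℝ)) :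
    (fun g => f (g - 1)) =O[atTop] fun g : ℕ => 1 / (g : ℝ) := by
  refine (hf.comp_tendsto (tendsto_sub_atTop_nat 1)).trans
    (isBigO_of_abs_le (C := 2) (n := 2) fun g hg => ?_)
  have hg' : (2 : ℝ) ≤ g := by exact_mod_cast hg
  simp only [Function.comp_apply]
  rw [Nat.cast_sub (by omega), Nat.cast_one, abs_of_nonneg (by apply one_div_nonneg.2; linarith),
    mul_one_div, div_le_div_iff₀ (by linarith) (by linarith)]
  linarith

lemma const_div_isBigO (c : ℝ) :
    (fun g : ℕ => c / (g : ℝ)) =O[atTop] fun g : ℕ => 1 / (g : ℝ) :=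
  ((isBigO_refl (fun g : ℕ => 1 / (g : ℝ)) atTop).const_mul_left c).congr_left fun g => by
    rw [mul_one_div]

lemma bR_ratio_sub_isBigO :
    (fun g : ℕ => bR (g - 1) / bR g - 4 * π ^ 2) =O[atTop] fun g : ℕ => 1 / (g : ℝ) ^ 2 :=
  isBigO_of_abs_le (C := 160 * π ^ 2) (n := 2) fun g hg => by
    rw [mul_one_div]; exact abs_bR_ratio_sub_le hg

lemma stepRatio_sub_isBigO :
    (fun g : ℕ => stepRatio g - 2 * π ^ 2 / g) =O[atTop] fun g : ℕ => 1 / (g : ℝ) ^ 2 := by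
  have h1 : (fun g : ℕ => 1 / (2 * ((g : ℝ) - 1))) =O[atTop] fun _ => (1 : ℝ) := by
    refine isBigO_of_abs_le (C := 1) (n := 2) fun g hg => ?_
    have hg' : (2 : ℝ) ≤ g := by exact_mod_cast hg
    rw [abs_of_nonneg (by apply one_div_nonneg.2; linarith), div_le_iff₀ (by linarith)]
    linarith
  have h2 : (fun g : ℕ => 1 / (2 * ((g : ℝ) - 1)) - 1 / (2 * g)) =O[atTop]
      fun g : ℕ => 1 / (g : ℝ) ^ 2 := by
    refine isBigO_of_abs_le (C := 1) (n := 2) fun g hg => ?_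
    have hg' : (2 : ℝ) ≤ g := by exact_mod_cast hg
    have h3 : 0 < (g : ℝ) - 1 := by linarith
    have : 1 / (2 * ((g : ℝ) - 1)) - 1 / (2 * g) = 1 / (2 * (g * (g - 1))) := by
      field_simp; ring
    rw [this, abs_of_nonneg (by positivity), one_mul]
    gcongr
    nlinarith
  have h3 := (bR_ratio_sub_isBigO.mul h1).add (h2.const_mul_left (4 * π ^ 2) |>.congr_right
    fun g => (mul_one _).symm)
  refine (h3.congr' ?_ ?_)
  · filter_upwards [eventually_ge_atTop 2] with g hg
    rw [stepRatio_eq hg]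
    ring
  · exact Eventually.of_forall fun g => mul_one _

lemma stepRatio_isBigO : stepRatio =O[atTop] fun g : ℕ => 1 / (g : ℝ) :=
  ((stepRatio_sub_isBigO.trans one_div_sq_isBigO).add (const_div_isBigO (2 * π ^ 2))).congr_left
    fun g => by ring

lemma normalized_isBigO_one {f : ℕ → ℝ} (hf : ∀ g : ℕ, 1 ≤ g → 0 < f g) {K : ℝ}
    (hK : ∀ g : ℕ, 2 ≤ g → (2 * (g : ℝ) - 1) * f g ≤ K * normSeq g) :
    (fun g : ℕ => normalized f (g - 1)) =O[atTop] fun _ => (1 : ℝ) := by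
  refine isBigO_of_abs_le (C := K) (n := 3) fun g hg => ?_
  have hN := normSeq_pos (g := g - 1) (by omega)
  have hw := weight_pos hf (g := g - 1) (by omega)
  rw [normalized, abs_of_nonneg (by positivity), mul_one, div_le_iff₀ hN]
  exact hK _ (by omega)

/-- If `h` tends to `c` at rate `1 / g`, then `stepRatio * h` is `2 π² c / g` up to `O(1 / g²)`. -/
lemma stepRatio_mul_sub_isBigO {h : ℕ → ℝ} {c : ℝ}
    (hh : (fun g => h g - c) =O[atTop] fun g : ℕ => 1 / (g : ℝ)) :
    (fun g : ℕ => stepRatio g * h g - 2 * π ^ 2 / g * c) =O[atTop]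
      fun g : ℕ => 1 / (g : ℝ) ^ 2 := by
  refine ((one_div_mul_isBigO stepRatio_isBigO hh).add
    (stepRatio_sub_isBigO.const_mul_left c)).congr_left fun g => ?_
  ring

variable {a d : ℕ → ℝ}

lemma normalized_volume_recursion_isBigO (hapos : ∀ g : ℕ, 1 ≤ g → 0 < a g)
    (ha : VolumeRecursion a) :
    (fun g : ℕ => normalized a g - (1 - 1 / 24 * (stepRatio g * normalized a (g - 1)))) =O[atTop]
      fun g : ℕ => 1 / (g : ℝ) ^ 2 := by
  have hX := normalized_isBigO_one hapos (K := 1) fun g hg => by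
    rw [one_mul]; exact weight_le_normSeq hapos ha (by omega)
  have h1 : (fun g : ℕ => normalized a g -
      (1 - (1 - 1 / (g : ℝ)) * (1 / 24) * stepRatio g * normalized a (g - 1))) =O[atTop]
      fun g : ℕ => 1 / (g : ℝ) ^ 2 :=
    isBigO_of_abs_le (C := 240) (n := 4) fun g hg => by
      rw [mul_one_div (240 : ℝ)]; exact abs_normalized_volume_sub_le hapos ha hg
  have h2 := (stepRatio_isBigO.mul hX).congr_right fun g => mul_one _
  refine (h1.add (one_div_mul_isBigO (const_div_isBigO (1 / 24)) h2)).congr_left fun g => ?_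
  ring

lemma normalized_volume_sub_one_isBigO (hapos : ∀ g : ℕ, 1 ≤ g → 0 < a g)
    (ha : VolumeRecursion a) :
    (fun g : ℕ => normalized a g - 1) =O[atTop] fun g : ℕ => 1 / (g : ℝ) := by
  have hX := normalized_isBigO_one hapos (K := 1) fun g hg => by
    rw [one_mul]; exact weight_le_normSeq hapos ha (by omega)
  have h2 := (stepRatio_isBigO.mul hX).congr_right fun g => mul_one _
  refine (((normalized_volume_recursion_isBigO hapos ha).trans one_div_sq_isBigO).sub
    (h2.const_mul_left (1 / 24))).congr_left fun g => ?_
  ring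

lemma normalized_volume_isBigO (hapos : ∀ g : ℕ, 1 ≤ g → 0 < a g) (ha : VolumeRecursion a) :
    (fun g : ℕ => normalized a g - (1 - π ^ 2 / 12 / g)) =O[atTop]
      fun g : ℕ => 1 / (g : ℝ) ^ 2 := by
  refine ((normalized_volume_recursion_isBigO hapos ha).sub ((stepRatio_mul_sub_isBigO
    (isBigO_pred (normalized_volume_sub_one_isBigO hapos ha))).const_mul_left
      (1 / 24))).congr_left fun g => ?_
  ring

lemma normalized_siegelVeech_recursion_isBigO (hapos : ∀ g : ℕ, 1 ≤ g → 0 < a g)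
    (hdpos : ∀ g : ℕ, 1 ≤ g → 0 < d g) (ha : VolumeRecursion a) (hd : SVRecursion a d) :
    (fun g : ℕ => normalized d g - (2 * π ^ 2 -
      1 / 24 * (stepRatio g * normalized d (g - 1)) - π ^ 2 / g)) =O[atTop]
      fun g : ℕ => 1 / (g : ℝ) ^ 2 := by
  have h1 : (fun g : ℕ => normalized d g - (bR (g - 1) / bR g / 2 -
      1 / 24 * stepRatio g * normalized d (g - 1) -
      1 / 2 * stepRatio g * (normalized a (g - 1) + powCoeffError a (g - 1)))) =O[atTop]
      fun g : ℕ => 1 / (g : ℝ) ^ 2 :=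
    isBigO_of_abs_le (C := 17920) (n := 4) fun g hg => by
      rw [mul_one_div]; exact abs_normalized_siegelVeech_sub_le hapos hdpos ha hd hg
  have h2 : powCoeffError a =O[atTop] fun g : ℕ => 1 / (g : ℝ) :=
    isBigO_of_abs_le (C := 48) (n := 2) fun g hg => by
      rw [mul_one_div]; exact abs_powCoeffError_le hapos ha hg
  have h3 : (fun g : ℕ => normalized a (g - 1) + powCoeffError a (g - 1) - 1) =O[atTop]
      fun g : ℕ => 1 / (g : ℝ) :=
    isBigO_pred (((normalized_volume_sub_one_isBigO hapos ha).add h2).congr_left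
      (f₂ := fun g => normalized a g + powCoeffError a g - 1) fun g => by ring)
  refine ((h1.add (bR_ratio_sub_isBigO.const_mul_left (1 / 2))).sub
    ((stepRatio_mul_sub_isBigO h3).const_mul_left (1 / 2))).congr_left fun g => ?_
  ring

lemma normalized_siegelVeech_isBigO (hapos : ∀ g : ℕ, 1 ≤ g → 0 < a g)
    (hdpos : ∀ g : ℕ, 1 ≤ g → 0 < d g) (ha : VolumeRecursion a) (hd : SVRecursion a d) :
    (fun g : ℕ => normalized d g - (2 * π ^ 2 - π ^ 4 / 6 / g - π ^ 2 / g)) =O[atTop]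
      fun g : ℕ => 1 / (g : ℝ) ^ 2 := by
  have hY := normalized_isBigO_one hdpos fun g hg =>
    weight_le_of_siegelVeech hapos hdpos hd hg
  have hrec := normalized_siegelVeech_recursion_isBigO hapos hdpos ha hd
  have h2 := (stepRatio_isBigO.mul hY).congr_right fun g => mul_one _
  have h3 : (fun g : ℕ => normalized d g - 2 * π ^ 2) =O[atTop] fun g : ℕ => 1 / (g : ℝ) :=
    (((hrec.trans one_div_sq_isBigO).sub (h2.const_mul_left (1 / 24))).sub
      (const_div_isBigO (π ^ 2))).congr_left fun g => by ring
  refine (hrec.sub ((stepRatio_mul_sub_isBigO (isBigO_pred h3)).const_mul_left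
    (1 / 24))).congr_left fun g => ?_
  ring

lemma siegelVeech_ratio_isBigO (hapos : ∀ g : ℕ, 1 ≤ g → 0 < a g)
    (hdpos : ∀ g : ℕ, 1 ≤ g → 0 < d g) (ha : VolumeRecursion a) (hd : SVRecursion a d) :
    (fun g : ℕ => d g / (4 * π ^ 2 * a g) - 1 / 2 + 1 / (4 * (g : ℝ))) =O[atTop]
      fun g : ℕ => 1 / (g : ℝ) ^ 2 := by
  have hX := normalized_volume_sub_one_isBigO hapos ha
  have hlim : Tendsto (normalized a) atTop (𝓝 1) := by
    have := (hX.trans_tendsto tendsto_one_div_atTop_nhds_zero_nat).add_const 1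
    simpa using this
  have hinv : (fun g => (normalized a g)⁻¹) =O[atTop] fun _ => (1 : ℝ) :=
    (hlim.inv₀ one_ne_zero).isBigO_one ℝ
  have hnum := ((normalized_siegelVeech_isBigO hapos hdpos ha hd).sub
    ((normalized_volume_isBigO hapos ha).const_mul_left (2 * π ^ 2))).add
    (one_div_mul_isBigO (const_div_isBigO (π ^ 2)) hX)
  refine ((hnum.mul hinv).const_mul_left (1 / (4 * π ^ 2))).congr' ?_
    (Eventually.of_forall fun g => mul_one _)
  filter_upwards [eventually_ge_atTop 1] with g hg
  have hpi := pi_pos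
  have hag := hapos g hg
  have hN := normSeq_pos hg
  have hg' : (1 : ℝ) ≤ g := by exact_mod_cast hg
  have hw : (2 : ℝ) * g - 1 ≠ 0 := by linarith
  have hXpos : normalized a g ≠ 0 := (div_pos (weight_pos hapos hg) hN).ne'
  have hratio : d g / (4 * π ^ 2 * a g) = normalized d g / (4 * π ^ 2 * normalized a g) := by
    rw [normalized, normalized]
    field_simp
  rw [hratio]
  field_simp
  ring

end Asymptotics

theorem stmt19 (a d : ℕ → ℝ)
    (hapos : ∀ g : ℕ, 1 ≤ g → 0 < a g) (hdpos : ∀ g : ℕ, 1 ≤ g → 0 < d g)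
    (ha : VolumeRecursion a) (hd : SVRecursion a d) :
    ∃ C > (0 : ℝ), ∃ g0 : ℕ, ∀ g : ℕ, g0 ≤ g →
      |d g / (4 * π ^ 2 * a g) - 1 / 2 + 1 / (4 * (g : ℝ))| ≤ C / (g : ℝ) ^ 2 := by
  obtain ⟨C, hC, h⟩ := (siegelVeech_ratio_isBigO hapos hdpos ha hd).exists_pos
  obtain ⟨g0, hg0⟩ := Filter.eventually_atTop.1 h.bound
  refine ⟨C, hC, g0, fun g hg => ?_⟩
  have := hg0 g hg
  rwa [norm_eq_abs, norm_eq_abs, abs_of_nonneg (a := 1 / (g : ℝ) ^ 2) (by positivity),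
    mul_one_div] at this
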